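/- arXiv:1803.01914 — 5 statements merged into one kernel-verified Lean document; each statement's English description precedes it below -/
import Mathlib

section
/- Let m ≥ 1 and let S ⊆ ℝ^m be the solution set of a finite conjunction of constraints on the coordinates x_1, …, x_m, each constraint having one of the forms x_i − x_j ≤ c, x_i ≤ c, or x_i ≥ c, where each constant c is an integer. Then S equals the convex hull of the set of its integer points, i.e., S = conv(S ∩ ℤ^m). -/
/-- A difference constraint on variables `x 0, …, x (m-1)`:
either `x i - x j ≤ c`, or `x i ≤ c`, or `x i ≥ c`, with `c` an integer. -/
inductive DiffConstraint (m : ℕ) where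
  | diff (i j : Fin m) (c : ℤ)   -- x i - x j ≤ c
  | upper (i : Fin m) (c : ℤ)    -- x i ≤ c
  | lower (i : Fin m) (c : ℤ)    -- x i ≥ c

/-- Satisfaction of a difference constraint by a point of ℝ^m. -/
def DiffConstraint.sat {m : ℕ} (x : Fin m → ℝ) : DiffConstraint m → Prop
  | .diff i j c => x i - x j ≤ (c : ℝ)
  | .upper i c => x i ≤ (c : ℝ)
  | .lower i c => (c : ℝ) ≤ x i

open MeasureTheory in
/-- The average over `t ∈ (0, 1]` of `⌊a + t⌋` is `a`. -/
lemma integral_floor_add (a : ℝ) : ∫ t in Set.Ioc (0 : ℝ) 1, (⌊a + t⌋ : ℝ) = a := by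
  have hfract : ∀ b : ℝ, IntervalIntegrable (fun t : ℝ => Int.fract (b + t)) volume 0 1 := by
    intro b
    rw [intervalIntegrable_iff]
    refine Measure.integrableOn_of_bounded (M := 1) (by simp) ?_ ?_
    · exact (measurable_fract.comp (measurable_const_add b)).aestronglyMeasurable
    · refine Filter.Eventually.of_forall fun t => ?_
      rw [Real.norm_eq_abs, abs_of_nonneg (Int.fract_nonneg _)]
      exact (Int.fract_lt_one _).le
  have hper : Function.Periodic (Int.fract : ℝ → ℝ) 1 := fun t => Int.fract_add_one t
  have hshift : ∫ t in (0 : ℝ)..1, Int.fract (a + t) = ∫ t in (0 : ℝ)..1, t := by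
    rw [intervalIntegral.integral_comp_add_left (fun t => Int.fract t) a, add_zero,
      hper.intervalIntegral_add_eq a 0, zero_add]
    refine intervalIntegral.integral_congr_ae ?_
    filter_upwards [Measure.ae_ne volume (1 : ℝ)] with t ht h
    rw [Set.uIoc_of_le zero_le_one] at h
    exact Int.fract_eq_self.2 ⟨h.1.le, lt_of_le_of_ne h.2 ht⟩
  rw [← intervalIntegral.integral_of_le zero_le_one]
  have hsplit : ∀ t : ℝ, (⌊a + t⌋ : ℝ) = (a + t) - Int.fract (a + t) := fun t => by
    rw [Int.self_sub_fract]
  simp_rw [hsplit]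
  rw [intervalIntegral.integral_sub ((continuous_const_add a).intervalIntegrable 0 1) (hfract a), hshift,
    intervalIntegral.integral_add intervalIntegrable_const intervalIntegral.intervalIntegrable_id]
  simp

/-- Rounding all coordinates down after a common shift `t ∈ [0, 1)` preserves difference
constraints with integer constants. -/
lemma DiffConstraint.sat.floor_add {m : ℕ} {x : Fin m → ℝ} {c : DiffConstraint m}
    (h : c.sat x) {t : ℝ} (ht0 : 0 ≤ t) (ht1 : t < 1) :
    c.sat (fun i => (⌊x i + t⌋ : ℝ)) := by
  cases c with
  | diff i j c =>
    simp only [DiffConstraint.sat] at h ⊢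
    have : ⌊x i + t⌋ ≤ ⌊x j + t⌋ + c := by
      rw [← Int.floor_add_intCast]
      exact Int.floor_le_floor (by linarith)
    have : (⌊x i + t⌋ : ℝ) ≤ ⌊x j + t⌋ + c := by exact_mod_cast this
    linarith
  | upper i c =>
    simp only [DiffConstraint.sat] at h ⊢
    have : ⌊x i + t⌋ < c + 1 := Int.floor_lt.2 (by push_cast; linarith)
    exact_mod_cast Int.lt_add_one_iff.1 this
  | lower i c =>
    simp only [DiffConstraint.sat] at h ⊢
    have : c ≤ ⌊x i + t⌋ := Int.le_floor.2 (by linarith)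
    exact_mod_cast this

/-- The points satisfying a difference constraint form a convex set. -/
lemma DiffConstraint.convex_setOf_sat {m : ℕ} (c : DiffConstraint m) :
    Convex ℝ {x | c.sat x} := by
  intro x hx y hy a b ha hb hab
  obtain rfl : b = 1 - a := by linarith
  cases c <;> simp only [DiffConstraint.sat, Set.mem_ofPred_eq, Pi.add_apply, Pi.smul_apply,
    smul_eq_mul] at hx hy ⊢ <;>
  nlinarith [mul_le_mul_of_nonneg_left hx ha, mul_le_mul_of_nonneg_left hy hb]

open MeasureTheory in
/-- A point lies in the convex hull of any set containing all its shifted roundings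
`(⌊x i + t⌋)ᵢ` for `t ∈ (0, 1)`. -/
lemma mem_convexHull_of_floor_add_mem {ι : Type*} [Fintype ι] {A : Set (ι → ℝ)} (x : ι → ℝ)
    (h : ∀ t : ℝ, 0 < t → t < 1 → (fun i => (⌊x i + t⌋ : ℝ)) ∈ A) :
    x ∈ convexHull ℝ A := by
  let V : Set (ι → ℝ) :=
    Set.univ.pi fun i => (fun z : ℤ => (z : ℝ)) '' Set.Icc ⌊x i⌋ (⌊x i⌋ + 1)
  have hV : ∀ t : ℝ, 0 < t → t ≤ 1 → (fun i => (⌊x i + t⌋ : ℝ)) ∈ V := by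
    refine fun t ht0 ht1 i _ => ⟨_, ⟨Int.floor_le_floor (by linarith), ?_⟩, rfl⟩
    rw [← Int.floor_add_one]
    exact Int.floor_le_floor (by linarith)
  have hfin : (A ∩ V).Finite :=
    (Set.Finite.pi' fun i => (Set.finite_Icc _ _).image _).subset fun y hy i => hy.2 i trivial
  have : IsProbabilityMeasure (volume.restrict (Set.Ioc (0 : ℝ) 1)) := ⟨by simp⟩
  have hint : ∀ i, Integrable (fun t : ℝ => (⌊x i + t⌋ : ℝ))
      (volume.restrict (Set.Ioc (0 : ℝ) 1)) := by
    intro i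
    refine Measure.integrableOn_of_bounded (M := |x i| + 2) (by simp) ?_ ?_
    · have : Measurable fun t : ℝ => ⌊x i + t⌋ := Int.measurable_floor.comp (measurable_const_add _)
      exact (measurable_from_top.comp this).aestronglyMeasurable
    · filter_upwards [ae_restrict_mem measurableSet_Ioc] with t ht
      rw [Real.norm_eq_abs, abs_le]
      have h1 := Int.floor_le (x i + t)
      have h2 := Int.lt_floor_add_one (x i + t)
      constructor <;> linarith [neg_abs_le (x i), le_abs_self (x i), ht.1, ht.2]
  have hmem : ∫ t in Set.Ioc (0 : ℝ) 1, (fun i => (⌊x i + t⌋ : ℝ)) ∈ convexHull ℝ (A ∩ V) := by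
    refine (convex_convexHull ℝ _).integral_mem (hfin.isClosed_convexHull ℝ) ?_ (.of_eval hint)
    filter_upwards [ae_restrict_mem measurableSet_Ioc,
      ae_restrict_of_ae (Measure.ae_ne volume (1 : ℝ))] with t ht ht1
    exact subset_convexHull ℝ _ ⟨h t ht.1 (lt_of_le_of_ne ht.2 ht1), hV t ht.1 ht.2⟩
  have heq : ∫ t in Set.Ioc (0 : ℝ) 1, (fun i => (⌊x i + t⌋ : ℝ)) = x := by
    ext i
    rw [eval_integral hint, integral_floor_add]
  rw [heq] at hmem
  exact convexHull_mono Set.inter_subset_left hmem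

/-- The solution set of a finite conjunction of difference constraints equals the
convex hull of its set of integer points. -/
theorem solution_set_eq_convexHull_integer_points
    (m : ℕ) (hm : 1 ≤ m) (C : List (DiffConstraint m))
    (S : Set (Fin m → ℝ)) (hS : S = {x | ∀ c ∈ C, c.sat x}) :
    S = convexHull ℝ (S ∩ {x : Fin m → ℝ | ∀ i, ∃ z : ℤ, x i = (z : ℝ)}) := by
  subst hS
  refine Set.Subset.antisymm (fun x hx => ?_) (convexHull_min Set.inter_subset_left ?_)
  · refine mem_convexHull_of_floor_add_mem x fun t ht0 ht1 => ⟨fun c hc => ?_, fun i => ⟨_, rfl⟩⟩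
    exact (hx c hc).floor_add ht0.le ht1
  · simp only [Set.ofPred_forall]
    exact convex_iInter₂ fun c _ => c.convex_setOf_sat
end

section
/- There exists a polynomial p in three variables with natural-number coefficients such that the following holds: for every monotone VASS Z = (n, Q, q₀, Q_f, Δ), the reachability set Reach_Z can be written as a finite union of ℕ-linear sets S(v₁, P₁), …, S(v_k, P_k) in which every component of every base vector v_i and of every period vector in P_i is at most p(n, |Q|, M)^n, where M is the maximum entry occurring among the vectors of the transitions in Δ. -/
/-- Reachability relation of a monotone VASS with initial state `q0` and
transition set `Δ`: `VassReach q0 Δ q u` says that the vector `u ∈ ℕ^n` is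
reachable in state `q`. -/
inductive VassReach {n : ℕ} {Q : Type} (q0 : Q) (Δ : Finset (Q × (Fin n → ℕ) × Q)) :
    Q → (Fin n → ℕ) → Prop
  | init : VassReach q0 Δ q0 0
  | step {q p : Q} {u v : Fin n → ℕ} :
      VassReach q0 Δ q u → (q, v, p) ∈ Δ → VassReach q0 Δ p (u + v)

/-- The ℕ-linear set with base vector `v` and set of period vectors `P`. -/
def NLinearSet {n : ℕ} (v : Fin n → ℕ) (P : Finset (Fin n → ℕ)) : Set (Fin n → ℕ) :=
  {w | ∃ a : (Fin n → ℕ) → ℕ, w = v + ∑ u ∈ P, a u • u}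

section CoveringRuns

open scoped Classical

variable {n : ℕ} {Q : Type} {Δ : Finset (Q × (Fin n → ℕ) × Q)}

/-- `VisitReach q0 Δ V q u`: some run from `q0` to `q` with effect `u` visits exactly the
states in `V`. -/
inductive VisitReach (q0 : Q) (Δ : Finset (Q × (Fin n → ℕ) × Q)) :
    Finset Q → Q → (Fin n → ℕ) → Prop
  | init : VisitReach q0 Δ {q0} q0 0
  | step {V : Finset Q} {q p : Q} {u v : Fin n → ℕ} :
      VisitReach q0 Δ V q u → (q, v, p) ∈ Δ → VisitReach q0 Δ (insert p V) p (u + v)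

/-- `SimpleReach r Δ S q y`: some run from `r` to `q` with effect `y` visits exactly the states
in `S`, each of them once. -/
inductive SimpleReach (r : Q) (Δ : Finset (Q × (Fin n → ℕ) × Q)) :
    Finset Q → Q → (Fin n → ℕ) → Prop
  | init : SimpleReach r Δ {r} r 0
  | step {S : Finset Q} {q p : Q} {y v : Fin n → ℕ} :
      SimpleReach r Δ S q y → p ∉ S → (q, v, p) ∈ Δ → SimpleReach r Δ (insert p S) p (y + v)

namespace VisitReach

variable {q0 q s t : Q} {V : Finset Q} {u c : Fin n → ℕ}

theorem vassReach (h : VisitReach q0 Δ V q u) : VassReach q0 Δ q u := by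
  induction h with
  | init => exact .init
  | step _ ht ih => exact ih.step ht

theorem trans (h : VisitReach q0 Δ V q u) (hc : VassReach q Δ t c) :
    ∃ V', V ⊆ V' ∧ VisitReach q0 Δ V' t (u + c) := by
  induction hc with
  | init => exact ⟨V, subset_rfl, by simpa using h⟩
  | step _ ht ih =>
    obtain ⟨V', hV, h'⟩ := ih
    exact ⟨_, hV.trans (Finset.subset_insert _ _), by rw [← add_assoc]; exact h'.step ht⟩

theorem insert_cycle (h : VisitReach q0 Δ V q u) (hs : s ∈ V) (hc : VassReach s Δ s c) :
    ∃ V', V ⊆ V' ∧ VisitReach q0 Δ V' q (u + c) := by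
  induction h with
  | init =>
    obtain rfl := Finset.mem_singleton.1 hs
    exact init.trans hc
  | @step V q p u v h ht ih =>
    rcases Finset.mem_insert.1 hs with rfl | hs
    · exact (h.step ht).trans hc
    · obtain ⟨V', hV, h'⟩ := ih hs
      exact ⟨_, Finset.insert_subset_insert _ hV, by rw [add_right_comm]; exact h'.step ht⟩

theorem add_mem_closure (h : VisitReach q0 Δ V q u) {z : Fin n → ℕ}
    (hz : z ∈ AddSubmonoid.closure {c | ∃ s ∈ V, VassReach s Δ s c}) :
    VassReach q0 Δ q (u + z) := by
  suffices ∃ V', V ⊆ V' ∧ VisitReach q0 Δ V' q (u + z) by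
    obtain ⟨_, -, h'⟩ := this
    exact h'.vassReach
  induction hz using AddSubmonoid.closure_induction_right with
  | zero => exact ⟨V, subset_rfl, by simpa using h⟩
  | add_right z _ c hc ih =>
    obtain ⟨V', hV, h'⟩ := ih
    obtain ⟨s, hs, hc⟩ := hc
    obtain ⟨V'', hV', h''⟩ := h'.insert_cycle (hV hs) hc
    exact ⟨V'', hV.trans hV', by rwa [← add_assoc]⟩

end VisitReach

namespace SimpleReach

variable {r q p : Q} {S : Finset Q} {y : Fin n → ℕ} {M : ℕ}

theorem exists_prefix (h : SimpleReach r Δ S q y) (hp : p ∈ S) :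
    ∃ S' y₁ y₂, S' ⊆ S ∧ SimpleReach r Δ S' p y₁ ∧ VassReach p Δ q y₂ ∧ y = y₁ + y₂ := by
  induction h with
  | init =>
    obtain rfl := Finset.mem_singleton.1 hp
    exact ⟨_, 0, 0, subset_rfl, init, .init, by simp⟩
  | @step S q p' y v h hp' ht ih =>
    rcases Finset.mem_insert.1 hp with rfl | hp
    · exact ⟨_, y + v, 0, subset_rfl, h.step hp' ht, .init, by simp⟩
    · obtain ⟨S', y₁, y₂, hS, h₁, h₂, rfl⟩ := ih hp
      exact ⟨S', y₁, y₂ + v, hS.trans (Finset.subset_insert _ _), h₁, h₂.step ht,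
        add_assoc _ _ _⟩

theorem apply_add_le (hM : ∀ t ∈ Δ, ∀ j, t.2.1 j ≤ M) (h : SimpleReach r Δ S q y) (j : Fin n) :
    y j + M ≤ S.card * M := by
  induction h with
  | init => simp
  | @step S q p y v h hp ht ih =>
    have := hM _ ht j
    rw [Finset.card_insert_of_notMem hp, add_mul, one_mul, Pi.add_apply]
    dsimp only at this
    omega

end SimpleReach

theorem VisitReach.trans_simple {q0 r q : Q} {V S : Finset Q} {b y : Fin n → ℕ}
    (hb : VisitReach q0 Δ V r b) (hy : SimpleReach r Δ S q y) (hSV : S ⊆ V) :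
    VisitReach q0 Δ V q (b + y) := by
  induction hy with
  | init => simpa using hb
  | step _ _ ht ih =>
    obtain ⟨hp, hS⟩ := Finset.insert_subset_iff.1 hSV
    have := (ih hS).step ht
    rwa [Finset.insert_eq_of_mem hp, add_assoc] at this

/-- Every run splits into a short run and cycles of small effect through states visited by it. -/
theorem VassReach.exists_short_add_cycles [Fintype Q] {q0 q : Q} {u : Fin n → ℕ} {M : ℕ}
    (hM : ∀ t ∈ Δ, ∀ j, t.2.1 j ≤ M) (h : VassReach q0 Δ q u) :
    ∃ V r b S y z, VisitReach q0 Δ V r b ∧ SimpleReach r Δ S q y ∧ S ⊆ V ∧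
      (∀ j, b j + Fintype.card Q * M ≤ V.card * (Fintype.card Q * M)) ∧
      z ∈ AddSubmonoid.closure
        {c | (∀ j, c j ≤ Fintype.card Q * M) ∧ ∃ s ∈ V, VassReach s Δ s c} ∧
      u = b + y + z := by
  induction h with
  | init =>
    exact ⟨_, _, _, _, _, 0, .init, .init, subset_rfl, by simp, zero_mem _, by simp⟩
  | @step q p u v _ ht ih =>
    obtain ⟨V, r, b, S, y, z, hb, hy, hSV, hbound, hz, rfl⟩ := ih
    have hyv (j : Fin n) : y j + v j ≤ Fintype.card Q * M := by
      have h₁ := hy.apply_add_le hM j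
      have h₂ := hM _ ht j
      have h₃ := Nat.mul_le_mul_right M S.card_le_univ
      dsimp only at h₂
      omega
    by_cases hpS : p ∈ S
    · obtain ⟨S', y₁, y₂, hS, h₁, h₂, rfl⟩ := hy.exists_prefix hpS
      refine ⟨V, r, b, S', y₁, z + (y₂ + v), hb, h₁, hS.trans hSV, hbound,
        add_mem hz (AddSubmonoid.subset_closure ⟨fun j => ?_, p, hSV hpS, h₂.step ht⟩), by abel⟩
      have := hyv j
      simp only [Pi.add_apply] at this ⊢
      omega
    by_cases hpV : p ∈ V
    · exact ⟨V, r, b, insert p S, y + v, z, hb, hy.step hpS ht,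
        Finset.insert_subset hpV hSV, hbound, hz, by abel⟩
    refine ⟨insert p V, p, b + y + v, {p}, 0, z, (hb.trans_simple hy hSV).step ht, .init,
      by simp, fun j => ?_, AddSubmonoid.closure_mono ?_ hz, by abel⟩
    · have h₁ := hyv j
      have h₂ := hbound j
      rw [Finset.card_insert_of_notMem hpV, add_mul, one_mul]
      simp only [Pi.add_apply]
      omega
    · rintro c ⟨hc, s, hs, hsc⟩
      exact ⟨hc, s, Finset.mem_insert_of_mem hs, hsc⟩

end CoveringRuns

/-- There is a polynomial `p` in three variables with natural-number coefficients such
that the reachability set of any monotone VASS `(n, Q, q0, Qf, Δ)` is a finite union of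
ℕ-linear sets whose base and period vectors have all components at most
`p(n, |Q|, M) ^ n`, where `M` is the maximum entry occurring among the vectors of the
transitions in `Δ`. -/
theorem reach_semilinear_bounded :
    ∃ p : MvPolynomial (Fin 3) ℕ,
      ∀ (n : ℕ) (Q : Type) [inst : Fintype Q] (q0 : Q) (Qf : Set Q)
        (Δ : Finset (Q × (Fin n → ℕ) × Q)) (M : ℕ),
        M = Δ.sup (fun t => Finset.univ.sup fun i => t.2.1 i) →
        ∃ (k : ℕ) (v : Fin k → (Fin n → ℕ)) (P : Fin k → Finset (Fin n → ℕ)),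
          ({u | ∃ q ∈ Qf, VassReach q0 Δ q u} = ⋃ i : Fin k, NLinearSet (v i) (P i)) ∧
          ∀ i : Fin k,
            (∀ j, v i j ≤ (MvPolynomial.eval ![n, Fintype.card Q, M] p) ^ n) ∧
            ∀ u ∈ P i, ∀ j, u j ≤ (MvPolynomial.eval ![n, Fintype.card Q, M] p) ^ n := by
  classical
  refine ⟨.X 1 * (.X 1 * .X 2) + .X 1 * .X 2, fun n Q _ q0 Qf Δ M hMdef => ?_⟩
  have hM : ∀ t ∈ Δ, ∀ j, t.2.1 j ≤ M := fun t ht j => by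
    subst hMdef
    exact (Finset.le_sup (f := t.2.1) (Finset.mem_univ j)).trans
      (Finset.le_sup (f := fun t : Q × (Fin n → ℕ) × Q => Finset.univ.sup fun i => t.2.1 i) ht)
  set C := Fintype.card Q with hC
  have heval : MvPolynomial.eval ![n, C, M]
      (.X 1 * (.X 1 * .X 2) + .X 1 * .X 2 : MvPolynomial (Fin 3) ℕ) = C * (C * M) + C * M := by
    simp
  rw [heval]
  have hpow {x : ℕ} (j : Fin n) (hx : x ≤ C * (C * M) + C * M) :
      x ≤ (C * (C * M) + C * M) ^ n :=
    hx.trans (Nat.le_self_pow j.pos.ne' _)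
  let I : Set (Finset Q × Q × (Fin n → ℕ)) :=
    {t | t.2.1 ∈ Qf ∧ VisitReach q0 Δ t.1 t.2.1 t.2.2 ∧ t.2.2 ≤ fun _ => C * (C * M)}
  have hI : I.Finite :=
    (Set.finite_univ.prod (Set.finite_univ.prod (Set.finite_Iic fun _ => C * (C * M)))).subset
      fun t ht => ⟨trivial, trivial, ht.2.2⟩
  have : Finite I := hI
  obtain ⟨k, ⟨e⟩⟩ := Finite.exists_equiv_fin I
  let P (V : Finset Q) : Finset (Fin n → ℕ) :=
    {c ∈ Finset.Iic fun _ => C * M | ∃ s ∈ V, VassReach s Δ s c}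
  refine ⟨k, fun i => (e.symm i).1.2.2, fun i => P (e.symm i).1.1, ?_, fun i =>
    ⟨fun j => hpow j (((e.symm i).2.2.2 j).trans (Nat.le_add_right _ _)), fun u hu j =>
      hpow j ((Finset.mem_Iic.1 (Finset.mem_filter.1 hu).1 j).trans (Nat.le_add_left _ _))⟩⟩
  ext u
  simp only [Set.mem_iUnion]
  constructor
  · rintro ⟨q, hq, hu⟩
    obtain ⟨V, r, b, S, y, z, hb, hy, hSV, hbound, hz, rfl⟩ := hu.exists_short_add_cycles hM
    have hmem : (V, q, b + y) ∈ I := by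
      refine ⟨hq, hb.trans_simple hy hSV, fun j => ?_⟩
      have h₁ := hy.apply_add_le hM j
      have h₂ := hbound j
      have h₃ := Nat.mul_le_mul_right M S.card_le_univ
      have h₄ := Nat.mul_le_mul_right (C * M) V.card_le_univ
      rw [← hC] at h₂ h₃ h₄
      simp only [Pi.add_apply]
      omega
    have hz' : z ∈ AddSubmonoid.closure (P V : Set (Fin n → ℕ)) := by
      refine AddSubmonoid.closure_mono ?_ hz
      rintro c ⟨hc, hs⟩
      exact Finset.mem_filter.2 ⟨Finset.mem_Iic.2 hc, hs⟩
    obtain ⟨a, -, rfl⟩ := AddSubmonoid.mem_closure_finset.1 hz'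
    refine ⟨e ⟨_, hmem⟩, ?_⟩
    rw [Equiv.symm_apply_apply]
    exact ⟨a, rfl⟩
  · rintro ⟨i, a, rfl⟩
    obtain ⟨hq, hv, -⟩ := (e.symm i).2
    refine ⟨_, hq, hv.add_mem_closure (sum_mem fun c hc => nsmul_mem ?_ _)⟩
    exact AddSubmonoid.subset_closure (Finset.mem_filter.1 hc).2
end

section
/- Let a, b, c be nonnegative integers, let T = {(x, y, z) ∈ ℝ³ : x ≥ 0, y ≥ 0, z ≥ 0, x ≤ a, y ≤ b, z ≥ c}, and let S be the convex hull of three affinely independent points p, q, r of ℝ³ with nonnegative coordinates. Then T ∩ S is nonempty if and only if at least one of the following holds: (a) at least one of p, q, r lies in T; (b) at least one of the closed segments [p,q], [q,r], [r,p] intersects the set {w ∈ T : w₁ = a} or the set {w ∈ T : w₂ = b}; (c) the set {(a, b, z) : z ≥ c} intersects S. -/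
/-- The target region `T = {(x,y,z) ∈ ℝ³ : x,y,z ≥ 0, x ≤ a, y ≤ b, z ≥ c}`. -/
def Tset (a b c : ℕ) : Set (Fin 3 → ℝ) :=
  {w | (∀ i, 0 ≤ w i) ∧ w 0 ≤ (a : ℝ) ∧ w 1 ≤ (b : ℝ) ∧ (c : ℝ) ≤ w 2}

/-- The face of `T` supported by the plane `x = a`. -/
def faceX (a b c : ℕ) : Set (Fin 3 → ℝ) := {w ∈ Tset a b c | w 0 = (a : ℝ)}

/-- The face of `T` supported by the plane `y = b`. -/
def faceY (a b c : ℕ) : Set (Fin 3 → ℝ) := {w ∈ Tset a b c | w 1 = (b : ℝ)}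

/-- The bounding edge of `T` supported by the line `x = a ∩ y = b`. -/
def edgeT (a b c : ℕ) : Set (Fin 3 → ℝ) :=
  {w | w 0 = (a : ℝ) ∧ w 1 = (b : ℝ) ∧ (c : ℝ) ≤ w 2}

theorem eventually_nonneg_add_mul {u e : ℝ} (hu : 0 ≤ u) (h : u = 0 → e = 0) :
    ∀ᶠ ε in nhds (0 : ℝ), 0 ≤ u + ε * e := by
  rcases hu.eq_or_lt with hu | hu
  · simp [← hu, h hu.symm]
  · have hc : Filter.Tendsto (fun ε : ℝ => u + ε * e) (nhds 0) (nhds u) :=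
      Continuous.tendsto' (by fun_prop) _ _ (by simp)
    exact (hc.eventually (lt_mem_nhds hu)).mono fun _ => le_of_lt

/-- The part of the standard simplex cut out by two linear inequalities. -/
def cutSimplex (x y : Fin 3 → ℝ) (α β : ℝ) : Set (Fin 3 → ℝ) :=
  {v ∈ stdSimplex ℝ (Fin 3) | v ⬝ᵥ x ≤ α ∧ v ⬝ᵥ y ≤ β}

theorem isCompact_cutSimplex (x y : Fin 3 → ℝ) (α β : ℝ) : IsCompact (cutSimplex x y α β) := by
  refine (isCompact_stdSimplex ℝ (Fin 3)).inter_right (IsClosed.and ?_ ?_) <;>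
    exact isClosed_le (by fun_prop) (by fun_prop)

/-- A linear functional on `cutSimplex` attains its maximum at an extreme point. -/
theorem exists_extremePoint_cutSimplex_max {x y : Fin 3 → ℝ} {α β : ℝ}
    (hne : (cutSimplex x y α β).Nonempty) (z : Fin 3 → ℝ) :
    ∃ v ∈ (cutSimplex x y α β).extremePoints ℝ, ∀ u ∈ cutSimplex x y α β, u ⬝ᵥ z ≤ v ⬝ᵥ z := by
  let l : StrongDual ℝ (Fin 3 → ℝ) := LinearMap.toContinuousLinearMap (dotProductBilin ℝ ℝ z)
  have hl : ∀ v, l v = v ⬝ᵥ z := fun v => dotProduct_comm z v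
  have hK := isCompact_cutSimplex x y α β
  obtain ⟨m, hm, hmax⟩ := hK.exists_isMaxOn hne l.continuous.continuousOn
  have hexp : IsExposed ℝ (cutSimplex x y α β) (l.toExposed (cutSimplex x y α β)) :=
    ContinuousLinearMap.toExposed.isExposed
  obtain ⟨v, hv⟩ := (hexp.isCompact hK).extremePoints_nonempty ⟨m, hm, fun u hu => hmax hu⟩
  refine ⟨v, hexp.isExtreme.extremePoints_subset_extremePoints hv, fun u hu => ?_⟩
  simpa only [hl] using hv.1.2 u hu

/-- At an extreme point of `cutSimplex` no nonzero direction preserves all tight constraints. -/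
theorem direction_eq_zero_of_mem_extremePoints {x y v d : Fin 3 → ℝ} {α β : ℝ}
    (hv : v ∈ (cutSimplex x y α β).extremePoints ℝ) (hsum : ∑ i, d i = 0)
    (hd : ∀ i, v i = 0 → d i = 0) (hx : v ⬝ᵥ x = α → d ⬝ᵥ x = 0)
    (hy : v ⬝ᵥ y = β → d ⬝ᵥ y = 0) : d = 0 := by
  obtain ⟨⟨⟨hv0, hv1⟩, hvx, hvy⟩, hext⟩ := hv
  have key : ∀ e : Fin 3 → ℝ, ∑ i, e i = 0 → (∀ i, v i = 0 → e i = 0) →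
      (v ⬝ᵥ x = α → e ⬝ᵥ x = 0) → (v ⬝ᵥ y = β → e ⬝ᵥ y = 0) →
      ∀ᶠ ε in nhds (0 : ℝ), v + ε • e ∈ cutSimplex x y α β := by
    intro e hs he hex hey
    have h0 := Filter.eventually_all.2 fun i => eventually_nonneg_add_mul (hv0 i) (he i)
    have h1 := eventually_nonneg_add_mul (e := -(e ⬝ᵥ x)) (sub_nonneg.2 hvx)
      fun h => by rw [hex (by linarith), neg_zero]
    have h2 := eventually_nonneg_add_mul (e := -(e ⬝ᵥ y)) (sub_nonneg.2 hvy)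
      fun h => by rw [hey (by linarith), neg_zero]
    filter_upwards [h0, h1, h2] with ε h0 h1 h2
    refine ⟨⟨h0, ?_⟩, ?_, ?_⟩
    · simp [Finset.sum_add_distrib, ← Finset.mul_sum, hs, hv1]
    · rw [add_dotProduct, smul_dotProduct, smul_eq_mul]; linarith
    · rw [add_dotProduct, smul_dotProduct, smul_eq_mul]; linarith
  have hpos := key d hsum hd hx hy
  have hneg := key (-d) (by simp [hsum]) (fun i hi => by simp [hd i hi])
    (fun h => by simp [hx h]) (fun h => by simp [hy h])
  obtain ⟨ε, ⟨h1, h2⟩, hε⟩ := (((hpos.and hneg).filter_mono nhdsWithin_le_nhds).and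
    (self_mem_nhdsWithin (s := Set.Ioi (0 : ℝ)))).exists
  have heq : v + ε • d = v := hext h1 h2
    ⟨1 / 2, 1 / 2, by norm_num, by norm_num, by norm_num, by ext i; simp; ring⟩
  exact (smul_eq_zero.1 (add_eq_left.1 heq)).resolve_left (ne_of_gt hε)

theorem exists_ne_zero_sum_eq_zero_dotProduct_eq_zero (y : Fin 3 → ℝ) :
    ∃ d : Fin 3 → ℝ, d ≠ 0 ∧ ∑ i, d i = 0 ∧ d ⬝ᵥ y = 0 := by
  by_cases h : y 0 = y 1
  · refine ⟨![1, -1, 0], fun h0 => by simpa using congrFun h0 0, ?_, ?_⟩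
    · simp [Fin.sum_univ_three]
    · simp [dotProduct, Fin.sum_univ_three, h]
  · refine ⟨![y 1 - y 2, y 2 - y 0, y 0 - y 1], fun h0 => h ?_, ?_, ?_⟩
    · simpa [sub_eq_zero] using congrFun h0 2
    · simp [Fin.sum_univ_three]
    · simp [dotProduct, Fin.sum_univ_three]; ring

theorem tight_constraints_of_mem_extremePoints {x y v : Fin 3 → ℝ} {α β : ℝ}
    (hv : v ∈ (cutSimplex x y α β).extremePoints ℝ) :
    (∃ i, v = Pi.single i 1) ∨ (∃ k, v k = 0 ∧ (v ⬝ᵥ x = α ∨ v ⬝ᵥ y = β)) ∨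
      (v ⬝ᵥ x = α ∧ v ⬝ᵥ y = β) := by
  by_cases hx : v ⬝ᵥ x = α <;> by_cases hy : v ⬝ᵥ y = β
  · exact .inr (.inr ⟨hx, hy⟩)
  · refine .inr (.inl ?_)
    by_contra! hk
    obtain ⟨d, hd, hs, hdx⟩ := exists_ne_zero_sum_eq_zero_dotProduct_eq_zero x
    exact hd (direction_eq_zero_of_mem_extremePoints hv hs
      (fun i hi => absurd hx (hk i hi).1) (fun _ => hdx) fun h => absurd h hy)
  · refine .inr (.inl ?_)
    by_contra! hk
    obtain ⟨d, hd, hs, hdy⟩ := exists_ne_zero_sum_eq_zero_dotProduct_eq_zero y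
    exact hd (direction_eq_zero_of_mem_extremePoints hv hs
      (fun i hi => absurd hy (hk i hi).2) (fun h => absurd h hx) fun _ => hdy)
  · refine .inl ?_
    have hpair : ∀ i j, i ≠ j → v i = 0 ∨ v j = 0 := by
      intro i j hij
      by_contra! h
      have hd : (Pi.single i 1 - Pi.single j 1 : Fin 3 → ℝ) = 0 :=
        direction_eq_zero_of_mem_extremePoints hv (by simp)
          (fun k hk => by
            have hki : k ≠ i := by rintro rfl; exact h.1 hk
            have hkj : k ≠ j := by rintro rfl; exact h.2 hk
            simp [hki, hkj])
          (fun h => absurd h hx) fun h => absurd h hy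
      simpa [hij] using congrFun hd i
    have hsum : ∑ i, v i = 1 := hv.1.1.2
    obtain ⟨i, hi⟩ : ∃ i, v i ≠ 0 := by
      by_contra! h
      simp [h] at hsum
    have hz : ∀ j, j ≠ i → v j = 0 := fun j hj => (hpair j i hj).resolve_right hi
    refine ⟨i, funext fun j => ?_⟩
    rw [Finset.sum_eq_single i (fun j _ hj => hz j hj) (by simp)] at hsum
    by_cases hj : j = i
    · subst hj; simpa using hsum
    · simp [hj, hz j hj]

theorem mem_convexHull_triple_iff {p q r w : Fin 3 → ℝ} :
    w ∈ convexHull ℝ {p, q, r} ↔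
      ∃ v ∈ stdSimplex ℝ (Fin 3), v 0 • p + v 1 • q + v 2 • r = w := by
  constructor
  · rw [convexHull_insert (by simp), convexHull_pair]
    simp only [mem_convexJoin, Set.mem_singleton_iff, exists_eq_left]
    rintro ⟨u, ⟨s, t, hs, ht, hst, rfl⟩, ⟨m, n, hm, hn, hmn, rfl⟩⟩
    refine ⟨![m, n * s, n * t], ⟨fun i => ?_, ?_⟩, ?_⟩
    · fin_cases i <;> simp <;> positivity
    · simp [Fin.sum_univ_three, add_assoc, ← mul_add, hst, hmn]
    · ext i; simp; ring
  · rintro ⟨v, ⟨hv0, hv1⟩, h⟩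
    refine mem_convexHull_of_exists_fintype v ![p, q, r] hv0 hv1 (fun i => ?_) ?_
    · fin_cases i <;> simp
    · simpa [Fin.sum_univ_three] using h

/-- `T` meets the 3-simplex `S = conv{p,q,r}` iff (a) some vertex of `S` lies in `T`, or
(b) some bounding edge of `S` meets the face of `T` supported by `x = a` or the face
supported by `y = b`, or (c) the bounding edge of `T` supported by `x = a ∩ y = b`
meets `S`. -/
theorem target_meets_simplex_iff
    (a b c : ℕ) (p q r : Fin 3 → ℝ)
    (hp : ∀ i, 0 ≤ p i) (hq : ∀ i, 0 ≤ q i) (hr : ∀ i, 0 ≤ r i)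
    (hind : AffineIndependent ℝ ![p, q, r]) :
    (Tset a b c ∩ convexHull ℝ {p, q, r}).Nonempty ↔
      ((p ∈ Tset a b c ∨ q ∈ Tset a b c ∨ r ∈ Tset a b c) ∨
       ((segment ℝ p q ∩ faceX a b c).Nonempty ∨ (segment ℝ p q ∩ faceY a b c).Nonempty ∨
        (segment ℝ q r ∩ faceX a b c).Nonempty ∨ (segment ℝ q r ∩ faceY a b c).Nonempty ∨
        (segment ℝ r p ∩ faceX a b c).Nonempty ∨ (segment ℝ r p ∩ faceY a b c).Nonempty) ∨
       (edgeT a b c ∩ convexHull ℝ {p, q, r}).Nonempty) := by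
  constructor
  · rintro ⟨w, ⟨hw0, hwa, hwb, hwc⟩, hw⟩
    obtain ⟨u, hu, rfl⟩ := mem_convexHull_triple_iff.1 hw
    have hdot : ∀ (v : Fin 3 → ℝ) (i : Fin 3),
        v ⬝ᵥ ![p i, q i, r i] = (v 0 • p + v 1 • q + v 2 • r) i := fun v i => by
      simp [dotProduct, Fin.sum_univ_three]
    obtain ⟨v, hv, hmax⟩ := exists_extremePoint_cutSimplex_max
      (x := ![p 0, q 0, r 0]) (y := ![p 1, q 1, r 1]) (α := a) (β := b)
      ⟨u, hu, (hdot u 0).trans_le hwa, (hdot u 1).trans_le hwb⟩ ![p 2, q 2, r 2]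
    obtain ⟨hvs, hva, hvb⟩ := hv.1
    have hvc : (c : ℝ) ≤ v ⬝ᵥ ![p 2, q 2, r 2] :=
      (hwc.trans_eq (hdot u 2).symm).trans
        (hmax u ⟨hu, (hdot u 0).trans_le hwa, (hdot u 1).trans_le hwb⟩)
    have htight := tight_constraints_of_mem_extremePoints hv
    rw [hdot] at hva hvb hvc
    rw [hdot, hdot] at htight
    have hvT : v 0 • p + v 1 • q + v 2 • r ∈ Tset a b c := by
      refine ⟨fun i => ?_, hva, hvb, hvc⟩
      have h0 := mul_nonneg (hvs.1 0) (hp i)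
      have h1 := mul_nonneg (hvs.1 1) (hq i)
      have h2 := mul_nonneg (hvs.1 2) (hr i)
      simpa using add_nonneg (add_nonneg h0 h1) h2
    have hsum : v 0 + v 1 + v 2 = 1 := by simpa [Fin.sum_univ_three] using hvs.2
    rcases htight with ⟨i, hi⟩ | ⟨k, hk, hface⟩ | ⟨hX, hY⟩
    · left
      fin_cases i <;> simp [hi] at hvT <;> tauto
    · right; left
      have hseg : v 0 • p + v 1 • q + v 2 • r ∈ segment ℝ p q ∨
          v 0 • p + v 1 • q + v 2 • r ∈ segment ℝ q r ∨
          v 0 • p + v 1 • q + v 2 • r ∈ segment ℝ r p := by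
        fin_cases k <;> simp only [Fin.zero_eta, Fin.mk_one, Fin.reduceFinMk] at hk
        · exact .inr (.inl ⟨v 1, v 2, hvs.1 1, hvs.1 2, by linarith, by simp [hk]⟩)
        · exact .inr (.inr ⟨v 2, v 0, hvs.1 2, hvs.1 0, by linarith, by simp [hk, add_comm]⟩)
        · exact .inl ⟨v 0, v 1, hvs.1 0, hvs.1 1, by linarith, by simp [hk]⟩
      rcases hface with hf | hf
      · rcases hseg with h | h | h
        · exact .inl ⟨_, h, hvT, hf⟩
        · exact .inr (.inr (.inl ⟨_, h, hvT, hf⟩))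
        · exact .inr (.inr (.inr (.inr (.inl ⟨_, h, hvT, hf⟩))))
      · rcases hseg with h | h | h
        · exact .inr (.inl ⟨_, h, hvT, hf⟩)
        · exact .inr (.inr (.inr (.inl ⟨_, h, hvT, hf⟩)))
        · exact .inr (.inr (.inr (.inr (.inr ⟨_, h, hvT, hf⟩))))
    · exact .inr (.inr ⟨_, ⟨hX, hY, hvc⟩, mem_convexHull_triple_iff.2 ⟨v, hvs, rfl⟩⟩)
  · have hpS : p ∈ convexHull ℝ {p, q, r} := subset_convexHull ℝ _ (by simp)
    have hqS : q ∈ convexHull ℝ {p, q, r} := subset_convexHull ℝ _ (by simp)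
    have hrS : r ∈ convexHull ℝ {p, q, r} := subset_convexHull ℝ _ (by simp)
    have hS := convex_convexHull ℝ {p, q, r}
    rintro ((h | h | h) | (⟨w, hs, h⟩ | ⟨w, hs, h⟩ | ⟨w, hs, h⟩ | ⟨w, hs, h⟩ | ⟨w, hs, h⟩ |
      ⟨w, hs, h⟩) | ⟨w, ⟨hX, hY, hZ⟩, hw⟩)
    · exact ⟨p, h, hpS⟩
    · exact ⟨q, h, hqS⟩
    · exact ⟨r, h, hrS⟩
    · exact ⟨w, h.1, hS.segment_subset hpS hqS hs⟩
    · exact ⟨w, h.1, hS.segment_subset hpS hqS hs⟩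
    · exact ⟨w, h.1, hS.segment_subset hqS hrS hs⟩
    · exact ⟨w, h.1, hS.segment_subset hqS hrS hs⟩
    · exact ⟨w, h.1, hS.segment_subset hrS hpS hs⟩
    · exact ⟨w, h.1, hS.segment_subset hrS hpS hs⟩
    · refine ⟨w, ⟨fun i => ?_, hX.le, hY.le, hZ⟩, hw⟩
      have hnn : convexHull ℝ {p, q, r} ⊆ Set.Ici (0 : Fin 3 → ℝ) :=
        convexHull_min (by rintro _ (rfl | rfl | rfl) <;> assumption) (convex_Ici 0)
      exact hnn hw i
end

section
/- Let a, b, c be nonnegative integers, let T' = {(x, y, z) ∈ ℝ³ : x ≥ 0, y ≥ 0, z ≥ 0, x ≥ a, y ≥ b, z ≤ c}, and let S be the convex hull of three affinely independent points p, q, r of ℝ³ with nonnegative coordinates. Then T' ∩ S is nonempty if and only if at least one of the following holds: (a) at least one of p, q, r lies in T'; (b) at least one of the closed segments [p,q], [q,r], [r,p] intersects the set {w ∈ T' : w₁ = a} or the set {w ∈ T' : w₂ = b}; (c) the set {(a, b, z) : 0 ≤ z ≤ c} intersects S. -/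
/-- The target region `T' = {(x,y,z) ∈ ℝ³ : x,y,z ≥ 0, x ≥ a, y ≥ b, z ≤ c}`. -/
def Tset' (a b c : ℕ) : Set (Fin 3 → ℝ) :=
  {w | (∀ i, 0 ≤ w i) ∧ (a : ℝ) ≤ w 0 ∧ (b : ℝ) ≤ w 1 ∧ w 2 ≤ (c : ℝ)}

/-- The face of `T'` supported by the plane `x = a`. -/
def faceX' (a b c : ℕ) : Set (Fin 3 → ℝ) := {w ∈ Tset' a b c | w 0 = (a : ℝ)}

/-- The face of `T'` supported by the plane `y = b`. -/
def faceY' (a b c : ℕ) : Set (Fin 3 → ℝ) := {w ∈ Tset' a b c | w 1 = (b : ℝ)}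

/-- The bounding edge of `T'` supported by the line `x = a ∩ y = b`. -/
def edgeT' (a b c : ℕ) : Set (Fin 3 → ℝ) :=
  {w | w 0 = (a : ℝ) ∧ w 1 = (b : ℝ) ∧ 0 ≤ w 2 ∧ w 2 ≤ (c : ℝ)}

theorem exists_ray_first_zero {ι : Type*} [Finite ι] (x d : ι → ℝ) (hx : ∀ i, 0 ≤ x i)
    (hd : ∃ i, d i < 0) :
    ∃ t : ℝ, 0 ≤ t ∧ (∀ i, 0 ≤ x i + t * d i) ∧ ∃ i, d i < 0 ∧ x i + t * d i = 0 := by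
  obtain ⟨j, hj, hmin⟩ := Set.exists_min_image {i | d i < 0} (fun i ↦ x i / -d i)
    (Set.toFinite _) hd
  have hj' : 0 < -d j := neg_pos.2 hj
  refine ⟨x j / -d j, div_nonneg (hx j) hj'.le, fun i ↦ ?_, j, hj, ?_⟩
  · rcases lt_or_ge (d i) 0 with hi | hi
    · have := (le_div_iff₀ (neg_pos.2 hi)).1 (hmin i hi)
      linarith
    · exact add_nonneg (hx i) (mul_nonneg (div_nonneg (hx j) hj'.le) hi)
  · have : d j ≠ 0 := hj.ne
    field_simp
    ring

theorem mem_convexHull_triple {p q r w : Fin 3 → ℝ} :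
    w ∈ convexHull ℝ {p, q, r} ↔ ∃ α β γ : ℝ, 0 ≤ α ∧ 0 ≤ β ∧ 0 ≤ γ ∧ α + β + γ = 1 ∧
      w = α • p + β • q + γ • r := by
  constructor
  · intro h
    rw [convexHull_insert (by simp), convexHull_pair, convexJoin_singleton_left] at h
    simp only [Set.mem_iUnion] at h
    obtain ⟨u, ⟨s, t, hs, ht, hst, rfl⟩, ⟨s', t', hs', ht', hst', rfl⟩⟩ := h
    refine ⟨s', t' * s, t' * t, hs', by positivity, by positivity, ?_, ?_⟩
    · linear_combination hst' + t' * hst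
    · module
  · rintro ⟨α, β, γ, hα, hβ, hγ, hsum, rfl⟩
    have hc := convex_convexHull ℝ ({p, q, r} : Set (Fin 3 → ℝ))
    have := hc.sum_mem (t := Finset.univ) (w := ![α, β, γ]) (z := ![p, q, r])
      (by simp [Fin.forall_fin_succ, hα, hβ, hγ])
      (by simpa [Fin.sum_univ_three] using hsum)
      (fun i _ ↦ subset_convexHull ℝ _ (by fin_cases i <;> simp))
    simpa [Fin.sum_univ_three] using this

theorem nonneg_of_mem_convexHull_triple {p q r w : Fin 3 → ℝ}
    (hp : ∀ i, 0 ≤ p i) (hq : ∀ i, 0 ≤ q i) (hr : ∀ i, 0 ≤ r i)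
    (hw : w ∈ convexHull ℝ {p, q, r}) (i : Fin 3) : 0 ≤ w i := by
  obtain ⟨α, β, γ, hα, hβ, hγ, -, rfl⟩ := mem_convexHull_triple.1 hw
  have := hp i
  have := hq i
  have := hr i
  simp only [Pi.add_apply, Pi.smul_apply, smul_eq_mul]
  positivity

/-- Moving inside a triangle along a nonzero direction or its opposite so that the last
coordinate does not increase, one reaches an edge of the triangle, the plane
`x = A` or the plane `y = B`. -/
theorem exists_exit_of_mem_convexHull_triple {p q r w : Fin 3 → ℝ} {A B : ℝ}
    (hw : w ∈ convexHull ℝ {p, q, r}) (hA : A ≤ w 0) (hB : B ≤ w 1)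
    {d e f : ℝ} (hsum : d + e + f = 0) (hne : d ≠ 0 ∨ e ≠ 0 ∨ f ≠ 0) :
    ∃ t : ℝ, ∃ w' ∈ convexHull ℝ {p, q, r}, w' = w + t • (d • p + e • q + f • r) ∧
      A ≤ w' 0 ∧ B ≤ w' 1 ∧ w' 2 ≤ w 2 ∧
      (w' ∈ segment ℝ p q ∨ w' ∈ segment ℝ q r ∨ w' ∈ segment ℝ r p ∨
        (w' 0 = A ∧ (d • p + e • q + f • r) 0 ≠ 0) ∨
        (w' 1 = B ∧ (d • p + e • q + f • r) 1 ≠ 0)) := by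
  wlog hz : (d • p + e • q + f • r) 2 ≤ 0 generalizing d e f
  · have hneg : (-d) • p + (-e) • q + (-f) • r = -(d • p + e • q + f • r) := by module
    obtain ⟨t, w', hw', hww', h1, h2, h3, h4⟩ := this (d := -d) (e := -e) (f := -f)
      (by linarith) (by simpa using hne)
      (by rw [hneg, Pi.neg_apply]; linarith [not_le.1 hz])
    refine ⟨-t, w', hw', by rw [hww']; module, h1, h2, h3, ?_⟩
    rwa [hneg, Pi.neg_apply, Pi.neg_apply, neg_ne_zero, neg_ne_zero] at h4
  set V := d • p + e • q + f • r with hV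
  obtain ⟨α, β, γ, hα, hβ, hγ, hs, hwe⟩ := mem_convexHull_triple.1 hw
  have hex : ∃ i, ![d, e, f, V 0, V 1] i < 0 := by
    by_contra! h
    have h0 := h 0
    have h1 := h 1
    have h2 := h 2
    simp at h0 h1 h2
    rcases hne with h | h | h <;> apply h <;> linarith
  obtain ⟨t, ht, hpos, i, hi, hzero⟩ := exists_ray_first_zero
    ![α, β, γ, w 0 - A, w 1 - B] ![d, e, f, V 0, V 1]
    (by simp [Fin.forall_fin_succ, hα, hβ, hγ, hA, hB]) hex
  have h0 := hpos 0
  have h1 := hpos 1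
  have h2 := hpos 2
  have h3 := hpos 3
  have h4 := hpos 4
  simp at h0 h1 h2 h3 h4
  have hw' : w + t • V = (α + t * d) • p + (β + t * e) • q + (γ + t * f) • r := by
    rw [hwe, hV]; module
  have hs' : (α + t * d) + (β + t * e) + (γ + t * f) = 1 := by
    linear_combination hs + t * hsum
  refine ⟨t, w + t • V, mem_convexHull_triple.2 ⟨_, _, _, h0, h1, h2, hs', hw'⟩, rfl,
    ?_, ?_, ?_, ?_⟩
  · simp only [Pi.add_apply, Pi.smul_apply, smul_eq_mul]; linarith
  · simp only [Pi.add_apply, Pi.smul_apply, smul_eq_mul]; linarith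
  · simp only [Pi.add_apply w, Pi.smul_apply t, smul_eq_mul]
    linarith [mul_nonpos_of_nonneg_of_nonpos ht hz]
  · fin_cases i <;> simp at hi hzero
    · refine .inr (.inl ⟨_, _, h1, h2, by linarith, ?_⟩)
      rw [hw', hzero]; module
    · refine .inr (.inr (.inl ⟨_, _, h2, h0, by linarith, ?_⟩))
      rw [hw', hzero]; module
    · refine .inl ⟨_, _, h0, h1, by linarith, ?_⟩
      rw [hw', hzero]; module
    · refine .inr (.inr (.inr (.inl ⟨?_, hi.ne⟩)))
      simp only [Pi.add_apply, Pi.smul_apply, smul_eq_mul]; linarith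
    · refine .inr (.inr (.inr (.inr ⟨?_, hi.ne⟩)))
      simp only [Pi.add_apply, Pi.smul_apply, smul_eq_mul]; linarith

/-- In a triangle, a linear form with values `x, y, z` at the vertices is constant along some
nonzero direction. -/
theorem exists_barycentric_direction (x y z : ℝ) :
    ∃ d e f : ℝ, d + e + f = 0 ∧ (d ≠ 0 ∨ e ≠ 0 ∨ f ≠ 0) ∧ d * x + e * y + f * z = 0 := by
  by_cases h : x = y
  · exact ⟨1, -1, 0, by norm_num, by norm_num, by rw [h]; ring⟩
  · exact ⟨y - z, z - x, x - y, by ring, .inr (.inr (sub_ne_zero.2 h)), by ring⟩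

theorem Tset'_inter_segment {a b c : ℕ} {p q u : Fin 3 → ℝ}
    (hp : ∀ i, 0 ≤ p i) (hq : ∀ i, 0 ≤ q i) (hu : u ∈ segment ℝ p q) (huT : u ∈ Tset' a b c) :
    p ∈ Tset' a b c ∨ q ∈ Tset' a b c ∨ (segment ℝ p q ∩ faceX' a b c).Nonempty ∨
      (segment ℝ p q ∩ faceY' a b c).Nonempty := by
  wlog hz : q 2 ≤ p 2 generalizing p q
  · have := this hq hp (segment_symm ℝ p q ▸ hu) (not_le.1 hz).le
    rw [segment_symm ℝ q p] at this
    tauto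
  obtain ⟨s, s', hs, hs', hss, hue⟩ := hu
  obtain ⟨-, hu0, hu1, hu2⟩ := huT
  obtain ⟨t, ht, hpos, i, hi, hzero⟩ := exists_ray_first_zero
    ![s, u 0 - a, u 1 - b] ![-1, q 0 - p 0, q 1 - p 1]
    (by simp [Fin.forall_fin_succ, hs, hu0, hu1]) ⟨0, by simp⟩
  have h0 := hpos 0
  have h1 := hpos 1
  have h2 := hpos 2
  simp at h0 h1 h2
  set v := u + t • (q - p) with hv
  have hve : (s - t) • p + (s' + t) • q = v := by rw [hv, ← hue]; module
  have hvs : v ∈ segment ℝ p q := ⟨s - t, s' + t, by linarith, by linarith, by linarith, hve⟩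
  have hvi (i) : v i = u i + t * (q i - p i) := rfl
  have hvT : v ∈ Tset' a b c := by
    refine ⟨fun i ↦ ?_, ?_, ?_, ?_⟩
    · have e : v i = (s - t) * p i + (s' + t) * q i := by rw [← hve]; rfl
      rw [e]
      exact add_nonneg (mul_nonneg (by linarith) (hp i)) (mul_nonneg (by linarith) (hq i))
    · rw [hvi]; linarith
    · rw [hvi]; linarith
    · rw [hvi]; linarith [mul_nonpos_of_nonneg_of_nonpos ht (sub_nonpos.2 hz)]
  fin_cases i <;> simp at hi hzero
  · have hvq : v = q := by
      rw [← hve, show s - t = 0 by linarith, show s' + t = 1 by linarith]; module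
    exact .inr (.inl (hvq ▸ hvT))
  · exact .inr (.inr (.inl ⟨v, hvs, hvT, by rw [hvi]; linarith⟩))
  · exact .inr (.inr (.inr ⟨v, hvs, hvT, by rw [hvi]; linarith⟩))

/-- `T'` meets the 3-simplex `S = conv{p,q,r}` iff (a) some vertex of `S` lies in `T'`,
or (b) some bounding edge of `S` meets the face of `T'` supported by `x = a` or the
face supported by `y = b`, or (c) the bounding edge of `T'` supported by
`x = a ∩ y = b` meets `S`. -/
theorem target_meets_simplex_iff'
    (a b c : ℕ) (p q r : Fin 3 → ℝ)
    (hp : ∀ i, 0 ≤ p i) (hq : ∀ i, 0 ≤ q i) (hr : ∀ i, 0 ≤ r i)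
    (hind : AffineIndependent ℝ ![p, q, r]) :
    (Tset' a b c ∩ convexHull ℝ {p, q, r}).Nonempty ↔
      ((p ∈ Tset' a b c ∨ q ∈ Tset' a b c ∨ r ∈ Tset' a b c) ∨
       ((segment ℝ p q ∩ faceX' a b c).Nonempty ∨ (segment ℝ p q ∩ faceY' a b c).Nonempty ∨
        (segment ℝ q r ∩ faceX' a b c).Nonempty ∨ (segment ℝ q r ∩ faceY' a b c).Nonempty ∨
        (segment ℝ r p ∩ faceX' a b c).Nonempty ∨ (segment ℝ r p ∩ faceY' a b c).Nonempty) ∨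
       (edgeT' a b c ∩ convexHull ℝ {p, q, r}).Nonempty) := by
  constructor
  · rintro ⟨w, ⟨-, hwa, hwb, hwc⟩, hw⟩
    have mem_T {v : Fin 3 → ℝ} (hv : v ∈ convexHull ℝ {p, q, r}) (h0 : (a : ℝ) ≤ v 0)
        (h1 : (b : ℝ) ≤ v 1) (h2 : v 2 ≤ c) : v ∈ Tset' a b c :=
      ⟨nonneg_of_mem_convexHull_triple hp hq hr hv, h0, h1, h2⟩
    obtain ⟨-, v, hv, -, hva, hvb, hvc, hcase⟩ := exists_exit_of_mem_convexHull_triple hw hwa hwb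
      (d := 1) (e := -1) (f := 0) (by norm_num) (by norm_num)
    have hvc' := hvc.trans hwc
    have hvT := mem_T hv hva hvb hvc'
    rcases hcase with h | h | h | ⟨h, -⟩ | ⟨h, -⟩
    · have := Tset'_inter_segment hp hq h hvT
      tauto
    · have := Tset'_inter_segment hq hr h hvT
      tauto
    · have := Tset'_inter_segment hr hp h hvT
      tauto
    · obtain ⟨d, e, f, hsum, hne, hdir⟩ := exists_barycentric_direction (p 0) (q 0) (r 0)
      obtain ⟨t, u, hu, huv, hua, hub, huc, hcase⟩ :=
        exists_exit_of_mem_convexHull_triple hv hva hvb hsum hne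
      have hV : (d • p + e • q + f • r) 0 = 0 := hdir
      have hu0 : u 0 = a := by
        rw [huv, Pi.add_apply, Pi.smul_apply, hV, smul_zero, add_zero, h]
      have huT := mem_T hu hua hub (huc.trans hvc')
      rcases hcase with h | h | h | ⟨-, h⟩ | ⟨h, -⟩
      · exact .inr (.inl (.inl ⟨u, h, huT, hu0⟩))
      · exact .inr (.inl (.inr (.inr (.inl ⟨u, h, huT, hu0⟩))))
      · exact .inr (.inl (.inr (.inr (.inr (.inr (.inl ⟨u, h, huT, hu0⟩))))))
      · exact absurd hV h
      · exact .inr (.inr ⟨u, ⟨hu0, h, huT.1 2, huT.2.2.2⟩, hu⟩)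
    · obtain ⟨d, e, f, hsum, hne, hdir⟩ := exists_barycentric_direction (p 1) (q 1) (r 1)
      obtain ⟨t, u, hu, huv, hua, hub, huc, hcase⟩ :=
        exists_exit_of_mem_convexHull_triple hv hva hvb hsum hne
      have hV : (d • p + e • q + f • r) 1 = 0 := hdir
      have hu1 : u 1 = b := by
        rw [huv, Pi.add_apply, Pi.smul_apply, hV, smul_zero, add_zero, h]
      have huT := mem_T hu hua hub (huc.trans hvc')
      rcases hcase with h | h | h | ⟨h, -⟩ | ⟨-, h⟩
      · exact .inr (.inl (.inr (.inl ⟨u, h, huT, hu1⟩)))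
      · exact .inr (.inl (.inr (.inr (.inr (.inl ⟨u, h, huT, hu1⟩)))))
      · exact .inr (.inl (.inr (.inr (.inr (.inr (.inr ⟨u, h, huT, hu1⟩))))))
      · exact .inr (.inr ⟨u, ⟨h, hu1, huT.1 2, huT.2.2.2⟩, hu⟩)
      · exact absurd hV h
  · have mem_hull {x y v : Fin 3 → ℝ} (hx : x ∈ ({p, q, r} : Set (Fin 3 → ℝ)))
        (hy : y ∈ ({p, q, r} : Set (Fin 3 → ℝ))) (hv : v ∈ segment ℝ x y) :
        v ∈ convexHull ℝ {p, q, r} :=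
      segment_subset_convexHull hx hy hv
    rintro ((h | h | h) | (⟨v, hv, hT, -⟩ | ⟨v, hv, hT, -⟩ | ⟨v, hv, hT, -⟩ | ⟨v, hv, hT, -⟩ |
      ⟨v, hv, hT, -⟩ | ⟨v, hv, hT, -⟩) | ⟨v, ⟨h0, h1, -, h3⟩, hv⟩)
    · exact ⟨p, h, subset_convexHull ℝ _ (by simp)⟩
    · exact ⟨q, h, subset_convexHull ℝ _ (by simp)⟩
    · exact ⟨r, h, subset_convexHull ℝ _ (by simp)⟩
    iterate 6 exact ⟨v, hT, mem_hull (by simp) (by simp) hv⟩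
    exact ⟨v, ⟨nonneg_of_mem_convexHull_triple hp hq hr hv, h0.ge, h1.ge, h3⟩, hv⟩
end

section
/- Let a, b, c be nonnegative integers, let T = {(x, y, z) ∈ ℝ³ : x ≥ 0, y ≥ 0, z ≥ 0, x ≤ a, y ≤ b, z ≥ c}, and let p, q, r, s be four points of ℝ³ with nonnegative coordinates. Then T intersects the convex hull of {p, q, r, s} if and only if T intersects the convex hull of some three of the four points p, q, r, s. -/
theorem exists_mem_stdSimplex_of_mem_convexHull_range {ι E : Type*} [Fintype ι]
    [AddCommGroup E] [Module ℝ E] {v : ι → E} {x : E} (hx : x ∈ convexHull ℝ (Set.range v)) :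
    ∃ w ∈ stdSimplex ℝ ι, ∑ i, w i • v i = x := by
  classical
  have h : Set.range v =
      Fintype.linearCombination ℝ v '' Set.range (fun i : ι ↦ Pi.single i (1 : ℝ)) := by
    rw [← Set.range_comp]
    congr 1
    ext1 i
    simp [Fintype.linearCombination_apply_single]
  rw [h, ← LinearMap.image_convexHull, convexHull_rangle_single_eq_stdSimplex] at hx
  obtain ⟨w, hw, rfl⟩ := hx
  exact ⟨w, hw, (Fintype.linearCombination_apply ℝ v w).symm⟩

/-- With one more coordinate than linear functionals, some nonzero direction of total weight zero
decreases none of the functionals. -/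
theorem exists_ne_zero_sum_eq_zero_and_nonneg {ι κ : Type*} [Fintype ι] [Fintype κ] [Nonempty κ]
    (hcard : Fintype.card ι = Fintype.card κ + 1) (A : (ι → ℝ) →ₗ[ℝ] (κ → ℝ)) :
    ∃ d : ι → ℝ, d ≠ 0 ∧ ∑ i, d i = 0 ∧ 0 ≤ A d := by
  let L : (ι → ℝ) →ₗ[ℝ] ℝ × (κ → ℝ) := (Fintype.linearCombination ℝ fun _ ↦ (1 : ℝ)).prod A
  have hL (d : ι → ℝ) : L d = (∑ i, d i, A d) := by
    simp [L, Fintype.linearCombination_apply]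
  by_cases hinj : Function.Injective L
  · have hrank : Module.finrank ℝ (ι → ℝ) = Module.finrank ℝ (ℝ × (κ → ℝ)) := by
      simp [hcard, add_comm]
    obtain ⟨d, hd⟩ := (LinearMap.injective_iff_surjective_of_finrank_eq_finrank hrank).1 hinj (0, 1)
    rw [hL, Prod.mk.injEq] at hd
    refine ⟨d, ?_, hd.1, hd.2 ▸ zero_le_one⟩
    rintro rfl
    exact zero_ne_one ((map_zero A).symm.trans hd.2)
  · rw [injective_iff_map_eq_zero] at hinj
    push Not at hinj
    obtain ⟨d, hd, hd0⟩ := hinj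
    rw [hL, Prod.mk_eq_zero] at hd
    exact ⟨d, hd0, hd.1, hd.2.ge⟩

/-- Moving from a point of the simplex in a nonzero direction of total weight zero eventually
reaches a facet. -/
theorem exists_add_smul_mem_stdSimplex_and_eq_zero {ι : Type*} [Fintype ι] {w d : ι → ℝ}
    (hw : w ∈ stdSimplex ℝ ι) (hd : d ≠ 0) (hsum : ∑ i, d i = 0) :
    ∃ t : ℝ, 0 ≤ t ∧ w + t • d ∈ stdSimplex ℝ ι ∧ ∃ i, (w + t • d) i = 0 := by
  have hneg : ∃ i, d i < 0 := by
    by_contra! h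
    exact hd (funext fun i ↦ (Finset.sum_eq_zero_iff_of_nonneg fun j _ ↦ h j).1 hsum i (by simp))
  obtain ⟨i, hi, hmin⟩ := (Finset.univ.filter fun i ↦ d i < 0).exists_min_image
    (fun i ↦ w i / -d i) (by simpa [Finset.Nonempty] using hneg)
  simp only [Finset.mem_filter, Finset.mem_univ, true_and] at hi hmin
  have ht : 0 ≤ w i / -d i := div_nonneg (hw.1 i) (by linarith)
  refine ⟨w i / -d i, ht, ⟨fun j ↦ ?_, ?_⟩, i, ?_⟩
  · rcases lt_or_ge (d j) 0 with hj | hj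
    · have := (le_div_iff₀ (neg_pos.2 hj)).1 (hmin j hj)
      simp only [Pi.add_apply, Pi.smul_apply, smul_eq_mul]
      linarith
    · exact add_nonneg (hw.1 j) (mul_nonneg ht hj)
  · simp [Finset.sum_add_distrib, ← Finset.mul_sum, hsum, hw.2]
  · simp only [Pi.add_apply, Pi.smul_apply, smul_eq_mul]
    field_simp [hi.ne]
    ring

theorem sum_smul_mem_convexHull_image_compl {ι E : Type*} [Fintype ι] [AddCommGroup E]
    [Module ℝ E] (v : ι → E) {w : ι → ℝ} (hw : w ∈ stdSimplex ℝ ι) {i : ι} (hi : w i = 0) :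
    ∑ j, w j • v j ∈ convexHull ℝ (v '' {i}ᶜ) := by
  classical
  rw [← Finset.sum_erase (a := i) _ (by simp [hi])]
  refine (convex_convexHull ℝ _).sum_mem (fun j _ ↦ hw.1 j) ?_ fun j hj ↦
    subset_convexHull ℝ _ ⟨j, by simpa using hj, rfl⟩
  rw [Finset.sum_erase _ hi, hw.2]

theorem exists_Tset_inter_convexHull_facet_nonempty {a b c : ℕ} {v : Fin 4 → Fin 3 → ℝ}
    (hv : ∀ i k, 0 ≤ v i k) (h : (Tset a b c ∩ convexHull ℝ (Set.range v)).Nonempty) :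
    ∃ i, (Tset a b c ∩ convexHull ℝ (v '' {i}ᶜ)).Nonempty := by
  obtain ⟨x, ⟨-, hxa, hxb, hxc⟩, hx⟩ := h
  obtain ⟨w, hw, rfl⟩ := exists_mem_stdSimplex_of_mem_convexHull_range hx
  obtain ⟨d, hd, hsum, hA⟩ := exists_ne_zero_sum_eq_zero_and_nonneg (κ := Fin 3) (by simp)
    (Fintype.linearCombination ℝ fun i : Fin 4 ↦ ![-v i 0, -v i 1, v i 2])
  obtain ⟨t, ht, hmem, i, hi⟩ := exists_add_smul_mem_stdSimplex_and_eq_zero hw hd hsum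
  refine ⟨i, ∑ j, (w + t • d) j • v j, ⟨fun k ↦ ?_, ?_⟩,
    sum_smul_mem_convexHull_image_compl v hmem hi⟩
  · rw [Finset.sum_apply]
    exact Finset.sum_nonneg fun j _ ↦ mul_nonneg (hmem.1 j) (hv j k)
  · have h0 := mul_nonneg ht (hA 0)
    have h1 := mul_nonneg ht (hA 1)
    have h2 := mul_nonneg ht (hA 2)
    simp [Fintype.linearCombination_apply] at h0 h1 h2
    simp only [Finset.sum_apply, Pi.smul_apply, Pi.add_apply, smul_eq_mul, add_mul, mul_assoc,
      Finset.sum_add_distrib, ← Finset.mul_sum] at hxa hxb hxc ⊢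
    exact ⟨by linarith, by linarith, by linarith⟩


/-- `T` meets the convex hull of four nonnegative points `p, q, r, s` of ℝ³ iff it meets
the convex hull of some three of them. -/
theorem target_meets_tetrahedron_iff_meets_face
    (a b c : ℕ) (p q r s : Fin 3 → ℝ)
    (hp : ∀ i, 0 ≤ p i) (hq : ∀ i, 0 ≤ q i) (hr : ∀ i, 0 ≤ r i) (hs : ∀ i, 0 ≤ s i) :
    (Tset a b c ∩ convexHull ℝ {p, q, r, s}).Nonempty ↔
      ((Tset a b c ∩ convexHull ℝ {p, q, r}).Nonempty ∨
       (Tset a b c ∩ convexHull ℝ {p, q, s}).Nonempty ∨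
       (Tset a b c ∩ convexHull ℝ {p, r, s}).Nonempty ∨
       (Tset a b c ∩ convexHull ℝ {q, r, s}).Nonempty) := by
  constructor
  · intro h
    obtain ⟨i, hi⟩ := exists_Tset_inter_convexHull_facet_nonempty (v := ![p, q, r, s])
      (by simp [Fin.forall_fin_succ, hp, hq, hr, hs])
      (by simpa only [Matrix.range_cons, Matrix.range_empty, Set.union_empty,
        Set.singleton_union] using h)
    have hface {A : Set (Fin 3 → ℝ)} (hA : ∀ j, j ≠ i → ![p, q, r, s] j ∈ A) :
        (Tset a b c ∩ convexHull ℝ A).Nonempty :=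
      hi.mono (Set.inter_subset_inter_right _ (convexHull_mono (Set.image_subset_iff.2 hA)))
    fin_cases i
    · exact .inr (.inr (.inr (hface (by simp [Fin.forall_fin_succ]))))
    · exact .inr (.inr (.inl (hface (by simp [Fin.forall_fin_succ]))))
    · exact .inr (.inl (hface (by simp [Fin.forall_fin_succ])))
    · exact .inl (hface (by simp [Fin.forall_fin_succ]))
  · rintro (h | h | h | h) <;>
      exact h.mono (Set.inter_subset_inter_right _ (convexHull_mono (by grind)))
end
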